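/- Let G=(V,w,m,d) be a salami with connected salami partition P=(X,Y,K). Then ℋ(P) consists of exactly one function up to additive constants: there exists h ∈ ℋ(P) such that ℋ(P) = {h + c : c ∈ ℝ}. -/

import Mathlib

open Filter

namespace SalamiPaper

variable {V : Type*}

/-- Locally finite: every vertex has finitely many neighbors. -/
def LocallyFinite (w : V → V → ℝ) : Prop := ∀ x : V, {y | 0 < w x y}.Finite

/-- Connectedness of the weighted graph: any two vertices are joined by a path. -/
def GraphConnected (w : V → V → ℝ) : Prop :=
  ∀ x y : V, Relation.ReflTransGen (fun a b => 0 < w a b) x y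

/-- The weighted graph Laplacian `Δf(x) = (1/m(x)) ∑_y w(x,y)(f(y)-f(x))`. -/
noncomputable def lap (w : V → V → ℝ) (m : V → ℝ) (f : V → ℝ) (x : V) : ℝ :=
  (m x)⁻¹ * ∑ᶠ y, w x y * (f y - f x)

/-- The vertex degree `Deg(x) = (1/m(x)) ∑_y w(x,y)`. -/
noncomputable def deg (w : V → V → ℝ) (m : V → ℝ) (x : V) : ℝ :=
  (m x)⁻¹ * ∑ᶠ y, w x y

/-- The set of `d`-lengths of adjacency paths from `x` to `y`. -/
def pathLens (w : V → V → ℝ) (d : V → V → ℝ) (x y : V) : Set ℝ :=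
  {L | ∃ (n : ℕ) (p : ℕ → V), p 0 = x ∧ p n = y ∧
    (∀ i < n, 0 < w (p i) (p (i + 1))) ∧
    L = ∑ i ∈ Finset.range n, d (p i) (p (i + 1))}

/-- `d` is a path metric on the graph with edge weight `w`. -/
def IsPathMetric (w : V → V → ℝ) (d : V → V → ℝ) : Prop :=
  (∀ x, d x x = 0) ∧ (∀ x y, x ≠ y → 0 < d x y) ∧ (∀ x y, d x y = d y x) ∧
  (∀ x y z, d x z ≤ d x y + d y z) ∧
  (∀ x y, d x y = sInf (pathLens w d x y))

/-- All balls are finite. -/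
def FiniteBalls (d : V → V → ℝ) : Prop := ∀ (x : V) (R : ℝ), {y | d x y ≤ R}.Finite

/-- The combinatorial graph distance (as a real number). -/
noncomputable def combDist (w : V → V → ℝ) (x y : V) : ℝ :=
  sInf {L | ∃ (n : ℕ) (p : ℕ → V), p 0 = x ∧ p n = y ∧
    (∀ i < n, 0 < w (p i) (p (i + 1))) ∧ L = (n : ℝ)}

/-- `Lip(1)`: the 1-Lipschitz functions with respect to `d`. -/
def Lip1 (d : V → V → ℝ) (f : V → ℝ) : Prop := ∀ x y, f y - f x ≤ d x y

/-- The Ollivier curvature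
`κ(x,y) = (1/d(x,y)) inf{Δf(x) - Δf(y) : f ∈ Lip(1), f(y)-f(x) = d(x,y)}`. -/
noncomputable def kappa (w : V → V → ℝ) (m : V → ℝ) (d : V → V → ℝ) (x y : V) : ℝ :=
  (d x y)⁻¹ * sInf {c | ∃ f : V → ℝ, Lip1 d f ∧ f y - f x = d x y ∧
    c = lap w m f x - lap w m f y}

/-- `m(A) = ∞`: the total measure of `A` is infinite. -/
def InfVolume (m : V → ℝ) (A : Set V) : Prop :=
  ∀ c : ℝ, ∃ F : Finset V, ↑F ⊆ A ∧ c < ∑ x ∈ F, m x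

/-- A salami partition `(X,Y,K)`. -/
def SalamiPartition (w : V → V → ℝ) (m : V → ℝ) (X Y K : Set V) : Prop :=
  X ∪ Y ∪ K = Set.univ ∧ Disjoint X Y ∧ Disjoint X K ∧ Disjoint Y K ∧
  K.Finite ∧ (∀ x ∈ X, ∀ y ∈ Y, w x y = 0) ∧ InfVolume m X ∧ InfVolume m Y

/-- Reachability inside a subset `A` of the vertex set. -/
def reachIn (w : V → V → ℝ) (A : Set V) : V → V → Prop :=
  Relation.ReflTransGen (fun a b => a ∈ A ∧ b ∈ A ∧ 0 < w a b)

/-- The induced subgraph on `A` is connected. -/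
def ConnectedIn (w : V → V → ℝ) (A : Set V) : Prop :=
  ∀ x ∈ A, ∀ y ∈ A, reachIn w A x y

/-- A connected salami partition: `K` induces a connected subgraph. -/
def ConnectedSalamiPartition (w : V → V → ℝ) (m : V → ℝ) (X Y K : Set V) : Prop :=
  SalamiPartition w m X Y K ∧ ConnectedIn w K

/-- The basic standing assumptions on a weighted graph `G = (V,w,m,d)`:
countable vertex set, symmetric non-negative edge weight vanishing on the diagonal,
positive vertex measure, local finiteness, connectedness,
`d` a path metric with finite balls. -/
def IsGraphBase (w : V → V → ℝ) (m : V → ℝ) (d : V → V → ℝ) : Prop :=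
  Countable V ∧ (∀ x y, w x y = w y x) ∧ (∀ x y, 0 ≤ w x y) ∧ (∀ x, w x x = 0) ∧
  (∀ x, 0 < m x) ∧ LocallyFinite w ∧ GraphConnected w ∧
  IsPathMetric w d ∧ FiniteBalls d

/-- Non-negative Ollivier curvature on all edges. -/
def NonnegCurv (w : V → V → ℝ) (m : V → ℝ) (d : V → V → ℝ) : Prop :=
  ∀ x y, 0 < w x y → 0 ≤ kappa w m d x y

/-- A salami: a connected, locally finite weighted graph with a path metric with
finite balls, non-negative Ollivier curvature, admitting a salami partition. -/
def IsSalami (w : V → V → ℝ) (m : V → ℝ) (d : V → V → ℝ) : Prop :=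
  IsGraphBase w m d ∧ NonnegCurv w m d ∧ ∃ X Y K : Set V, SalamiPartition w m X Y K

/-- `G` has at least `n` ends: there is a finite set `K` such that `V ∖ K` has at
least `n` infinite connected components. -/
def atLeastEnds (w : V → V → ℝ) (n : ℕ) : Prop :=
  ∃ K : Set V, K.Finite ∧ ∃ x : Fin n → V,
    (∀ i, x i ∉ K) ∧ (∀ i, {y | reachIn w Kᶜ (x i) y}.Infinite) ∧
    (∀ i j, i ≠ j → ¬ reachIn w Kᶜ (x i) (x j))

/-- `Lip(1,K)`: functions that are 1-Lipschitz on `K`. -/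
def Lip1On (d : V → V → ℝ) (K : Set V) (f : V → ℝ) : Prop :=
  ∀ x ∈ K, ∀ y ∈ K, f y - f x ≤ d x y

open Classical in
/-- The extremal Lipschitz extension operator `S(P)` of the salami partition
`P = (X,Y,K)`. -/
noncomputable def Sop (d : V → V → ℝ) (X Y K : Set V) (f : V → ℝ) : V → ℝ :=
  fun v =>
    if v ∈ K then f v
    else if v ∈ X then sSup {c | ∃ u ∈ K, c = f u - d v u}
    else sInf {c | ∃ u ∈ K, c = f u + d v u}

/-- `ℱ(P) = S(P)(Lip(1,K))`. -/
def calF (d : V → V → ℝ) (X Y K : Set V) : Set (V → ℝ) :=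
  {g | ∃ f : V → ℝ, Lip1On d K f ∧ g = Sop d X Y K f}

/-- `ℋ(P)`: the harmonic functions in `ℱ(P)`. -/
def calH (w : V → V → ℝ) (m : V → ℝ) (d : V → V → ℝ) (X Y K : Set V) :
    Set (V → ℝ) :=
  {g | g ∈ calF d X Y K ∧ ∀ x, lap w m g x = 0}

/-- `∇₊f(x) = max_{y∼x} (f(y)-f(x))/d(x,y)`. -/
noncomputable def gradPlus (w : V → V → ℝ) (d : V → V → ℝ) (f : V → ℝ) (x : V) : ℝ :=
  sSup {c | ∃ y, 0 < w x y ∧ c = (f y - f x) / d x y}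

/-- `∇₋f(x) = max_{y∼x} (f(x)-f(y))/d(x,y)`. -/
noncomputable def gradMinus (w : V → V → ℝ) (d : V → V → ℝ) (f : V → ℝ) (x : V) : ℝ :=
  sSup {c | ∃ y, 0 < w x y ∧ c = (f x - f y) / d x y}

/-- `|∇f|(x) = max_{y∼x} |f(y)-f(x)|/d(x,y)`. -/
noncomputable def gradAbs (w : V → V → ℝ) (d : V → V → ℝ) (f : V → ℝ) (x : V) : ℝ :=
  sSup {c | ∃ y, 0 < w x y ∧ c = |f y - f x| / d x y}

/-- Recurrence: for every `ε > 0` there is a finitely supported `f` with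
`‖f‖∞ = 1` and `-⟨f, Δf⟩ < ε`. -/
def Recurrent (w : V → V → ℝ) (m : V → ℝ) : Prop :=
  ∀ ε : ℝ, 0 < ε → ∃ f : V → ℝ, (Function.support f).Finite ∧
    (∀ x, |f x| ≤ 1) ∧ (∃ x, |f x| = 1) ∧
    -(∑ᶠ x, f x * lap w m f x * m x) < ε

open Classical in
/-- `∑_{x,y : f(y) < 0 ≤ f(x)} w(x,y)(f(x)-f(y))`. -/
noncomputable def cutSum (w : V → V → ℝ) (f : V → ℝ) : ℝ :=
  ∑ᶠ p : V × V, if f p.2 < 0 ∧ 0 ≤ f p.1 then w p.1 p.2 * (f p.1 - f p.2) else 0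

/-- Subexponential growth: `max_{B_r(x)} |u| = e^{o(r)}` as `r → ∞`. -/
def SubexpGrowth (d : V → V → ℝ) (x : V) (u : V → ℝ) : Prop :=
  Filter.Tendsto
    (fun r : ℕ => Real.log (sSup {c | ∃ y, d x y ≤ (r : ℝ) ∧ c = |u y|}) / (r : ℝ))
    Filter.atTop (nhds 0)


section Laplacian

variable {w : V → V → ℝ} {m : V → ℝ}

theorem lap_eq_sum (hw : ∀ x y, 0 ≤ w x y) (f : V → ℝ) (x : V) (S : Finset V)
    (hS : ∀ y, 0 < w x y → y ∈ S) :
    lap w m f x = (m x)⁻¹ * ∑ y ∈ S, w x y * (f y - f x) := by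
  unfold lap
  congr 1
  apply finsum_eq_sum_of_support_subset
  intro y hy
  apply hS
  have : w x y ≠ 0 := fun h => hy (by simp [h])
  exact lt_of_le_of_ne (hw x y) this.symm

theorem deg_eq_sum (hw : ∀ x y, 0 ≤ w x y) (x : V) (S : Finset V)
    (hS : ∀ y, 0 < w x y → y ∈ S) :
    deg w m x = (m x)⁻¹ * ∑ y ∈ S, w x y := by
  unfold deg
  congr 1
  apply finsum_eq_sum_of_support_subset
  intro y hy
  exact hS y (lt_of_le_of_ne (hw x y) (Ne.symm hy))

theorem deg_nonneg (hw : ∀ x y, 0 ≤ w x y) (hm : ∀ x, 0 < m x) (x : V) : 0 ≤ deg w m x :=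
  mul_nonneg (inv_nonneg.2 (hm x).le) (finsum_nonneg (hw x))

theorem lap_neg (f : V → ℝ) (x : V) : lap w m (fun v => -f v) x = -lap w m f x := by
  unfold lap
  rw [← mul_neg, ← finsum_neg_distrib]
  congr 1
  apply finsum_congr
  intro y
  ring

theorem lap_add_const (f : V → ℝ) (c : ℝ) (x : V) :
    lap w m (fun v => f v + c) x = lap w m f x := by
  simp [lap]

/-- Comparison of Laplacians of two functions with comparable increments at `x`. -/
theorem lap_le_lap_add (hw : ∀ x y, 0 ≤ w x y) (hm : ∀ x, 0 < m x) (hl : LocallyFinite w)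
    {f g : V → ℝ} {x : V} {δ : ℝ}
    (h : ∀ y, 0 < w x y → f y - f x ≤ g y - g x + δ) :
    lap w m f x ≤ lap w m g x + δ * deg w m x := by
  have hN : ∀ y, 0 < w x y → y ∈ (hl x).toFinset := by simp
  rw [lap_eq_sum hw f x _ hN, lap_eq_sum hw g x _ hN, deg_eq_sum hw x _ hN, mul_left_comm,
    ← mul_add, Finset.mul_sum _ _ δ, ← Finset.sum_add_distrib]
  refine mul_le_mul_of_nonneg_left (Finset.sum_le_sum fun y hy => ?_) (inv_nonneg.2 (hm x).le)
  have := mul_le_mul_of_nonneg_left (h y (by simpa using hy)) (hw x y)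
  linarith

theorem lap_le_lap (hw : ∀ x y, 0 ≤ w x y) (hm : ∀ x, 0 < m x) (hl : LocallyFinite w)
    {f g : V → ℝ} {x : V} (h : ∀ y, 0 < w x y → f y - f x ≤ g y - g x) :
    lap w m f x ≤ lap w m g x := by
  simpa using lap_le_lap_add hw hm hl (δ := 0) (by simpa using h)

/-- Strong minimum principle, one step. -/
theorem sub_eq_of_min (hw : ∀ x y, 0 ≤ w x y) (hm : ∀ x, 0 < m x) (hl : LocallyFinite w)
    {f g : V → ℝ} {p q : V} (hmin : ∀ v, g p - f p ≤ g v - f v)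
    (hlap : lap w m g p ≤ lap w m f p) (hq : 0 < w p q) : g q - f q = g p - f p := by
  have hN : ∀ y, 0 < w p y → y ∈ (hl p).toFinset := by simp
  rw [lap_eq_sum hw f p _ hN, lap_eq_sum hw g p _ hN,
    mul_le_mul_iff_right₀ (inv_pos.2 (hm p))] at hlap
  have hle : ∀ y ∈ (hl p).toFinset, w p y * (f y - f p) ≤ w p y * (g y - g p) := fun y _ =>
    mul_le_mul_of_nonneg_left (by linarith [hmin y]) (hw p y)
  have heq := (Finset.sum_eq_sum_iff_of_le hle).1 (le_antisymm (Finset.sum_le_sum hle) hlap)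
    q (hN q hq)
  have := mul_left_cancel₀ hq.ne' heq
  linarith

theorem add_mul_lap_le (hw : ∀ x y, 0 ≤ w x y) (hm : ∀ x, 0 < m x) (hl : LocallyFinite w)
    {f g : V → ℝ} {c ε : ℝ} {x : V} (hε : 0 ≤ ε) (hdeg : ε * deg w m x ≤ 1)
    (h : ∀ v, f v ≤ g v + c) :
    f x + ε * lap w m f x ≤ g x + ε * lap w m g x + c := by
  have h1 : lap w m f x ≤ lap w m g x + (g x + c - f x) * deg w m x :=
    lap_le_lap_add hw hm hl fun y _ => by linarith [h y]
  have h2 := mul_le_mul_of_nonneg_left h1 hε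
  have h3 := mul_le_mul_of_nonneg_left hdeg (sub_nonneg.2 (h x))
  linarith

end Laplacian

section PathMetric

variable {w : V → V → ℝ} {d : V → V → ℝ}

theorem pathLens_nonempty (hc : GraphConnected w) (x y : V) : (pathLens w d x y).Nonempty := by
  suffices ∃ (n : ℕ) (p : ℕ → V), p 0 = x ∧ p n = y ∧ ∀ i < n, 0 < w (p i) (p (i + 1)) by
    obtain ⟨n, p, h0, hn, hp⟩ := this
    exact ⟨_, n, p, h0, hn, hp, rfl⟩
  induction hc x y with
  | refl => exact ⟨0, fun _ => x, rfl, rfl, by simp⟩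
  | @tail b c _ hbc ih =>
    obtain ⟨n, p, h0, hn, hp⟩ := ih
    refine ⟨n + 1, fun i => if i ≤ n then p i else c, by simpa using h0, by simp, ?_⟩
    intro i hi
    rcases Nat.lt_succ_iff_lt_or_eq.1 hi with h | h
    · simpa [h.le, Nat.succ_le_of_lt h] using hp i h
    · subst h
      simpa [hn] using hbc

theorem dist_le_sum_Ico (hd : IsPathMetric w d) (p : ℕ → V) {a b : ℕ} (hab : a ≤ b) :
    d (p a) (p b) ≤ ∑ i ∈ Finset.Ico a b, d (p i) (p (i + 1)) := by
  induction b, hab using Nat.le_induction with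
  | base => simp [hd.1]
  | succ b hab ih =>
    rw [Finset.sum_Ico_succ_top hab]
    exact (hd.2.2.2.1 _ (p b) _).trans (by linarith)

theorem dist_add_dist_le_sum (hd : IsPathMetric w d) (p : ℕ → V) {i n : ℕ} (hi : i ≤ n) :
    d (p 0) (p i) + d (p i) (p n) ≤ ∑ i ∈ Finset.range n, d (p i) (p (i + 1)) := by
  rw [Finset.range_eq_Ico, ← Finset.sum_Ico_consecutive _ (Nat.zero_le i) hi]
  exact add_le_add (dist_le_sum_Ico hd p (Nat.zero_le i)) (dist_le_sum_Ico hd p hi)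

/-- If a finite set meets every path from `x` to `y`, then some point of it lies on a
geodesic from `x` to `y`. -/
theorem exists_mem_between (hd : IsPathMetric w d) (hc : GraphConnected w) {x y : V}
    {A : Set V} (hA : A.Finite)
    (hcut : ∀ (n : ℕ) (p : ℕ → V), p 0 = x → p n = y →
      (∀ i < n, 0 < w (p i) (p (i + 1))) → ∃ i ≤ n, p i ∈ A) :
    ∃ z ∈ A, d x z + d z y ≤ d x y := by
  have hne : A.Nonempty := by
    obtain ⟨_, n, p, h0, hn, hp, -⟩ := pathLens_nonempty (d := d) hc x y
    obtain ⟨i, -, hi⟩ := hcut n p h0 hn hp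
    exact ⟨_, hi⟩
  obtain ⟨z, hz, hmin⟩ := Set.exists_min_image A (fun z => d x z + d z y) hA hne
  refine ⟨z, hz, ?_⟩
  rw [hd.2.2.2.2 x y]
  refine le_csInf (pathLens_nonempty hc x y) ?_
  rintro _ ⟨n, p, h0, hn, hp, rfl⟩
  obtain ⟨i, hi, hiA⟩ := hcut n p h0 hn hp
  refine (hmin _ hiA).trans ?_
  have := dist_add_dist_le_sum hd p hi
  rwa [h0, hn] at this

theorem exists_step (hd : IsPathMetric w d) (hc : GraphConnected w) (hl : LocallyFinite w)
    {x y : V} (hxy : x ≠ y) : ∃ z, 0 < w x z ∧ d x z + d z y ≤ d x y := by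
  refine exists_mem_between hd hc (hl x) ?_
  intro n p h0 hn hp
  have hn0 : 0 < n := by
    rcases Nat.eq_zero_or_pos n with h | h
    · subst h
      exact absurd (h0.symm.trans hn) hxy
    · exact h
  refine ⟨1, hn0, ?_⟩
  have := hp 0 hn0
  rwa [h0] at this

end PathMetric

section Curvature

variable {w : V → V → ℝ} {m : V → ℝ} {d : V → V → ℝ}

theorem lap_le_of_edge (hG : IsGraphBase w m d) (hκ : NonnegCurv w m d) {f : V → ℝ}
    (hf : Lip1 d f) {x y : V} (hxy : 0 < w x y) (h : f y - f x = d x y) :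
    lap w m f y ≤ lap w m f x := by
  obtain ⟨-, -, hw, hw0, hm, hl, -, hd, -⟩ := hG
  have hne : x ≠ y := by
    rintro rfl
    exact hxy.ne' (hw0 x)
  have hpos : 0 < (d x y)⁻¹ := inv_pos.2 (hd.2.1 x y hne)
  have h0 := hκ x y hxy
  unfold kappa at h0
  have h1 := nonneg_of_mul_nonneg_right h0 hpos
  refine sub_nonneg.1 (h1.trans (csInf_le ?_ ⟨f, hf, h, rfl⟩))
  refine ⟨lap w m (fun z => -d x z) x - lap w m (fun z => d y z) y, ?_⟩
  rintro _ ⟨g, hg, -, rfl⟩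
  refine sub_le_sub (lap_le_lap hw hm hl fun z _ => ?_) (lap_le_lap hw hm hl fun z _ => ?_)
  · have := hg z x
    rw [hd.2.2.1 z x] at this
    simp only [hd.1]
    linarith
  · have := hg y z
    simp only [hd.1]
    linarith

/-- Non-negative curvature on edges propagates to all pairs of vertices. -/
theorem lap_le_of_sub_eq (hG : IsGraphBase w m d) (hκ : NonnegCurv w m d) {f : V → ℝ}
    (hf : Lip1 d f) {x y : V} (h : f y - f x = d x y) :
    lap w m f y ≤ lap w m f x := by
  have hG' := hG
  obtain ⟨-, -, hw, hw0, hm, hl, hc, hd, hb⟩ := hG'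
  have hfin : ∀ x, {v | d v y < d x y}.Finite := fun x =>
    (hb y (d x y)).subset fun v hv => by
      have : d v y < d x y := hv
      rw [hd.2.2.1 v y] at this
      exact this.le
  induction hn : {v | d v y < d x y}.ncard using Nat.strong_induction_on generalizing x with
  | _ n ih =>
    by_cases hxy : x = y
    · rw [hxy]
    obtain ⟨z, hz, hzd⟩ := exists_step hd hc hl hxy
    have hxz : x ≠ z := by
      rintro rfl
      exact hz.ne' (hw0 x)
    have hpos := hd.2.1 x z hxz
    have h1 := hf x z
    have h2 := hf z y
    refine (ih _ ?_ (by linarith) rfl).trans (lap_le_of_edge hG hκ hf hz (by linarith))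
    rw [← hn]
    refine Set.ncard_lt_ncard ⟨fun v hv => ?_, fun hsub => ?_⟩ (hfin x)
    · have : d v y < d z y := hv
      show d v y < d x y
      linarith
    · have : d z y < d z y := hsub (show d z y < d x y by linarith)
      exact lt_irrefl _ this

/-- For small `ε`, the operator `1 + ε Δ` preserves the Lipschitz constant. -/
theorem lip_add_mul_lap (hG : IsGraphBase w m d) (hκ : NonnegCurv w m d) {f : V → ℝ}
    (hf : Lip1 d f) {ε : ℝ} (hε : 0 ≤ ε) {x y : V} (hx : ε * deg w m x ≤ 1 / 2)
    (hy : ε * deg w m y ≤ 1 / 2) :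
    (f y + ε * lap w m f y) - (f x + ε * lap w m f x) ≤ d x y := by
  obtain ⟨-, -, hw, hw0, hm, hl, hc, hd, hb⟩ := id hG
  set δ := d x y - (f y - f x) with hδ
  have hδ0 : 0 ≤ δ := by linarith [hf x y]
  set g : V → ℝ := fun v => max (f v) (f y + δ - d v y) with hg
  have hgf : ∀ v, f v ≤ g v := fun v => le_max_left _ _
  have hgf' : ∀ v, g v ≤ f v + δ := fun v =>
    max_le (by linarith) (by linarith [hf v y])
  have hgx : g x = f x := by
    simp only [hg]
    rw [max_eq_left]
    linarith
  have hgy : g y = f y + δ := by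
    simp only [hg, hd.1]
    rw [max_eq_right] <;> linarith
  have hglip : Lip1 d g := by
    intro a b
    rw [sub_le_iff_le_add]
    refine max_le ?_ ?_
    · linarith [hf a b, hgf a]
    · have h1 : f y + δ - d a y ≤ g a := le_max_right _ _
      linarith [hd.2.2.2.1 a b y]
  have h1 : lap w m g y ≤ lap w m g x := lap_le_of_sub_eq hG hκ hglip (by linarith)
  have h2 : lap w m f y ≤ lap w m g y + δ * deg w m y :=
    lap_le_lap_add hw hm hl fun z _ => by linarith [hgf z]
  have h3 : lap w m g x ≤ lap w m f x + δ * deg w m x :=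
    lap_le_lap_add hw hm hl fun z _ => by linarith [hgf' z]
  have h4 : ε * (lap w m f y - lap w m f x) ≤ ε * (δ * deg w m y + δ * deg w m x) :=
    mul_le_mul_of_nonneg_left (by linarith) hε
  have h5 := mul_le_mul_of_nonneg_left (add_le_add hx hy) hδ0
  linarith

end Curvature

section Extremal

variable {w : V → V → ℝ} {m : V → ℝ} {d : V → V → ℝ} {X Y K : Set V}

/-- Intrinsic description of the members of `ℱ(P)`. -/
def IsExtremal (d : V → V → ℝ) (X Y K : Set V) (f : V → ℝ) : Prop :=
  Lip1 d f ∧ (∀ x ∈ X, ∃ k ∈ K, f x = f k - d x k) ∧ ∀ y ∈ Y, ∃ k ∈ K, f y = f k + d y k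

theorem IsExtremal.neg_swap {f : V → ℝ} (hs : ∀ x y, d x y = d y x)
    (hf : IsExtremal d X Y K f) : IsExtremal d Y X K (fun v => -f v) := by
  obtain ⟨h1, h2, h3⟩ := hf
  refine ⟨fun x y => ?_, fun x hx => ?_, fun x hx => ?_⟩
  · have := h1 y x
    rw [hs y x] at this
    linarith
  · obtain ⟨k, hk, h⟩ := h3 x hx
    exact ⟨k, hk, by linarith⟩
  · obtain ⟨k, hk, h⟩ := h2 x hx
    exact ⟨k, hk, by linarith⟩

theorem IsExtremal.add_const {f : V → ℝ} (hf : IsExtremal d X Y K f) (c : ℝ) :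
    IsExtremal d X Y K (fun v => f v + c) := by
  obtain ⟨h1, h2, h3⟩ := hf
  refine ⟨fun x y => ?_, fun x hx => ?_, fun x hx => ?_⟩
  · have := h1 x y
    linarith
  · obtain ⟨k, hk, h⟩ := h2 x hx
    exact ⟨k, hk, by linarith⟩
  · obtain ⟨k, hk, h⟩ := h3 x hx
    exact ⟨k, hk, by linarith⟩

theorem IsExtremal.mono {f : V → ℝ} {X' Y' K' : Set V} (hf : IsExtremal d X Y K f)
    (hX : X' ⊆ X) (hY : Y' ⊆ Y) (hK : K ⊆ K') : IsExtremal d X' Y' K' f := by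
  obtain ⟨h1, h2, h3⟩ := hf
  refine ⟨h1, fun x hx => ?_, fun x hx => ?_⟩
  · obtain ⟨k, hk, h⟩ := h2 x (hX hx)
    exact ⟨k, hK hk, h⟩
  · obtain ⟨k, hk, h⟩ := h3 x (hY hx)
    exact ⟨k, hK hk, h⟩

/-- Extremal functions are compared on `K`. -/
theorem IsExtremal.le_add {f g : V → ℝ} (hs : ∀ x y, d x y = d y x)
    (hU : X ∪ Y ∪ K = Set.univ) (hf : IsExtremal d X Y K f) (hg : IsExtremal d X Y K g)
    {c : ℝ} (h : ∀ k ∈ K, f k ≤ g k + c) (v : V) : f v ≤ g v + c := by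
  have hv : v ∈ X ∪ Y ∪ K := hU ▸ Set.mem_univ v
  rcases hv with (hv | hv) | hv
  · obtain ⟨k, hk, e⟩ := hf.2.1 v hv
    linarith [h k hk, hg.1 v k]
  · obtain ⟨k, hk, e⟩ := hg.2.2 v hv
    have := hf.1 k v
    rw [hs k v] at this
    linarith [h k hk]
  · exact h v hv

theorem SalamiPartition.swap (hs : ∀ x y, w x y = w y x) (h : SalamiPartition w m X Y K) :
    SalamiPartition w m Y X K := by
  obtain ⟨h1, h2, h3, h4, h5, h6, h7, h8⟩ := h
  exact ⟨by rw [Set.union_comm Y X, h1], h2.symm, h4, h3, h5,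
    fun x hx y hy => by rw [hs, h6 y hy x hx], h8, h7⟩

theorem SalamiPartition.exists_between (hd : IsPathMetric w d) (hc : GraphConnected w)
    (hP : SalamiPartition w m X Y K) {x y : V} (hx : x ∈ X) (hy : y ∈ Y) :
    ∃ k ∈ K, d x k + d k y ≤ d x y := by
  obtain ⟨hU, hXY, -, -, hK, hE, -, -⟩ := hP
  refine exists_mem_between hd hc hK ?_
  intro n p h0 hn hp
  by_contra! hno
  have key : ∀ i ≤ n, p i ∈ X := by
    intro i
    induction i with
    | zero => intro _; rwa [h0]
    | succ i ih =>
      intro hi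
      have h1 := ih (by omega)
      have h2 := hp i (by omega)
      have hv : p (i + 1) ∈ X ∪ Y ∪ K := hU ▸ Set.mem_univ _
      rcases hv with (hv | hv) | hv
      · exact hv
      · exact absurd (hE _ h1 _ hv) h2.ne'
      · exact absurd hv (hno _ hi)
  exact Set.disjoint_left.1 hXY (key n le_rfl) (hn ▸ hy)

theorem InfVolume.nonempty {A : Set V} (h : InfVolume m A) : A.Nonempty := by
  obtain ⟨F, hF, h0⟩ := h 0
  rcases F.eq_empty_or_nonempty with rfl | ⟨x, hx⟩
  · simp at h0
  · exact ⟨x, hF hx⟩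

theorem SalamiPartition.nonempty (hd : IsPathMetric w d) (hc : GraphConnected w)
    (hP : SalamiPartition w m X Y K) : K.Nonempty := by
  obtain ⟨x, hx⟩ := hP.2.2.2.2.2.2.1.nonempty
  obtain ⟨y, hy⟩ := hP.2.2.2.2.2.2.2.nonempty
  obtain ⟨k, hk, -⟩ := hP.exists_between hd hc hx hy
  exact ⟨k, hk⟩

theorem Sop_of_mem_K {f : V → ℝ} {v : V} (hv : v ∈ K) : Sop d X Y K f v = f v := by
  simp [Sop, hv]

theorem isExtremal_Sop (hd : IsPathMetric w d) (hc : GraphConnected w)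
    (hP : SalamiPartition w m X Y K) {f : V → ℝ} (hf : Lip1On d K f) :
    IsExtremal d X Y K (Sop d X Y K f) := by
  have hne := hP.nonempty hd hc
  obtain ⟨hU, hXY, hXK, hYK, hK, hE, -, -⟩ := id hP
  have hs := hd.2.2.1
  have ht := hd.2.2.2.1
  have hSX : ∀ x ∈ X, (∃ k ∈ K, Sop d X Y K f x = f k - d x k) ∧
      ∀ k ∈ K, f k - d x k ≤ Sop d X Y K f x := by
    intro x hx
    obtain ⟨k, hk, hmax⟩ := Set.exists_max_image K (fun k => f k - d x k) hK hne
    have hgr : IsGreatest {c | ∃ u ∈ K, c = f u - d x u} (f k - d x k) := by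
      refine ⟨⟨k, hk, rfl⟩, ?_⟩
      rintro _ ⟨u, hu, rfl⟩
      exact hmax u hu
    have e : Sop d X Y K f x = f k - d x k := by
      rw [← hgr.csSup_eq]
      simp [Sop, hx, Set.disjoint_left.1 hXK hx]
    exact ⟨⟨k, hk, e⟩, fun u hu => e ▸ hmax u hu⟩
  have hSY : ∀ y ∈ Y, (∃ k ∈ K, Sop d X Y K f y = f k + d y k) ∧
      ∀ k ∈ K, Sop d X Y K f y ≤ f k + d y k := by
    intro x hx
    obtain ⟨k, hk, hmin⟩ := Set.exists_min_image K (fun k => f k + d x k) hK hne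
    have hgr : IsLeast {c | ∃ u ∈ K, c = f u + d x u} (f k + d x k) := by
      refine ⟨⟨k, hk, rfl⟩, ?_⟩
      rintro _ ⟨u, hu, rfl⟩
      exact hmin u hu
    have e : Sop d X Y K f x = f k + d x k := by
      rw [← hgr.csInf_eq]
      simp [Sop, Set.disjoint_right.1 hXY hx, Set.disjoint_left.1 hYK hx]
    exact ⟨⟨k, hk, e⟩, fun u hu => e ▸ hmin u hu⟩
  have hSK : ∀ k ∈ K, Sop d X Y K f k = f k := fun k hk => Sop_of_mem_K hk
  refine ⟨fun a b => ?_, fun x hx => ?_, fun y hy => ?_⟩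
  · have ha : a ∈ X ∪ Y ∪ K := hU ▸ Set.mem_univ _
    have hb : b ∈ X ∪ Y ∪ K := hU ▸ Set.mem_univ _
    rcases ha with (ha | ha) | ha <;> rcases hb with (hb | hb) | hb
    · obtain ⟨k, hk, e⟩ := (hSX b hb).1
      linarith [(hSX a ha).2 k hk, ht a b k]
    · obtain ⟨k, hk, e⟩ := hP.exists_between hd hc ha hb
      linarith [(hSX a ha).2 k hk, (hSY b hb).2 k hk, hs b k]
    · linarith [(hSX a ha).2 b hb, hSK b hb]
    · obtain ⟨k, hk, e⟩ := (hSX b hb).1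
      obtain ⟨l, hl, e'⟩ := (hSY a ha).1
      linarith [hf l hl k hk, ht l a k, ht a b k, hs l a]
    · obtain ⟨k, hk, e⟩ := (hSY a ha).1
      linarith [(hSY b hb).2 k hk, ht b a k, hs a b]
    · obtain ⟨k, hk, e⟩ := (hSY a ha).1
      linarith [hf k hk b hb, ht k a b, hs k a, hSK b hb]
    · obtain ⟨k, hk, e⟩ := (hSX b hb).1
      linarith [hf a ha k hk, ht a b k, hSK a ha]
    · linarith [(hSY b hb).2 a ha, hSK a ha, hs a b]
    · linarith [hf a ha b hb, hSK a ha, hSK b hb]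
  · obtain ⟨k, hk, e⟩ := (hSX x hx).1
    exact ⟨k, hk, by rw [e, hSK k hk]⟩
  · obtain ⟨k, hk, e⟩ := (hSY y hy).1
    exact ⟨k, hk, by rw [e, hSK k hk]⟩

theorem IsExtremal.mem_calF (hs : ∀ x y, d x y = d y x) (hP : SalamiPartition w m X Y K)
    {f : V → ℝ} (hf : IsExtremal d X Y K f) : f ∈ calF d X Y K := by
  obtain ⟨hU, hXY, hXK, hYK, -, -, -, -⟩ := hP
  refine ⟨f, fun x _ y _ => hf.1 x y, funext fun v => ?_⟩
  have hv : v ∈ X ∪ Y ∪ K := hU ▸ Set.mem_univ _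
  rcases hv with (hv | hv) | hv
  · obtain ⟨k, hk, e⟩ := hf.2.1 v hv
    have hgr : IsGreatest {c | ∃ u ∈ K, c = f u - d v u} (f v) := by
      refine ⟨⟨k, hk, e⟩, ?_⟩
      rintro _ ⟨u, hu, rfl⟩
      linarith [hf.1 v u]
    simp [Sop, hv, Set.disjoint_left.1 hXK hv, hgr.csSup_eq]
  · obtain ⟨k, hk, e⟩ := hf.2.2 v hv
    have hgr : IsLeast {c | ∃ u ∈ K, c = f u + d v u} (f v) := by
      refine ⟨⟨k, hk, e⟩, ?_⟩
      rintro _ ⟨u, hu, rfl⟩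
      linarith [hf.1 u v, hs u v]
    simp [Sop, Set.disjoint_right.1 hXY hv, Set.disjoint_left.1 hYK hv, hgr.csInf_eq]
  · exact (Sop_of_mem_K hv).symm

theorem mem_calF_iff (hd : IsPathMetric w d) (hc : GraphConnected w)
    (hP : SalamiPartition w m X Y K) {f : V → ℝ} :
    f ∈ calF d X Y K ↔ IsExtremal d X Y K f := by
  refine ⟨?_, fun h => h.mem_calF hd.2.2.1 hP⟩
  rintro ⟨g, hg, rfl⟩
  exact isExtremal_Sop hd hc hP hg

end Extremal

section Flux

variable {w : V → V → ℝ} {m : V → ℝ} {d : V → V → ℝ} {X Y K : Set V}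

open Classical in
/-- An extremal function cannot have Laplacian uniformly positive on `X`: the flux through the
lower level sets would exceed the flux through the boundary of `X`. -/
theorem IsExtremal.not_lap_ge (hG : IsGraphBase w m d) (hP : SalamiPartition w m X Y K)
    {f : V → ℝ} (hf : IsExtremal d X Y K f) {C : ℝ} (hC : 0 < C)
    (h : ∀ x ∈ X, C ≤ lap w m f x) : False := by
  obtain ⟨-, hws, hw, hw0, hm, hl, hc, hd, hb⟩ := hG
  obtain ⟨hU, hXY, hXK, hYK, hK, hE, hvol, -⟩ := hP
  have hdnn : ∀ x y, 0 ≤ d x y := by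
    intro x y
    by_cases hxy : x = y
    · rw [hxy, hd.1]
    · exact (hd.2.1 x y hxy).le
  set B := ∑ k ∈ hK.toFinset, ∑ x ∈ (hl k).toFinset, w x k * d x k with hB
  obtain ⟨F, hFX, hF⟩ := hvol (B / C)
  obtain ⟨t, ht⟩ : ∃ t, ∀ x ∈ F, t < f x := by
    obtain ⟨t, ht⟩ := (F.image f).bddBelow
    refine ⟨t - 1, fun x hx => ?_⟩
    have := ht (by simpa using ⟨x, hx, rfl⟩ : f x ∈ ↑(F.image f))
    linarith
  have hAfin : {x | x ∈ X ∧ t < f x}.Finite := by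
    refine (hK.biUnion fun k _ => hb k (f k - t)).subset ?_
    rintro x ⟨hx, hxt⟩
    obtain ⟨k, hk, e⟩ := hf.2.1 x hx
    simp only [Set.mem_iUnion, Set.mem_ofPred_eq, exists_prop]
    refine ⟨k, hk, ?_⟩
    linarith [hd.2.2.1 x k]
  set A := hAfin.toFinset with hA
  have hmemA : ∀ x, x ∈ A ↔ x ∈ X ∧ t < f x := by simp [hA]
  set S := A ∪ hK.toFinset ∪ A.biUnion (fun x => (hl x).toFinset) with hS
  have hmul : ∀ x ∈ A, m x * C ≤ ∑ y ∈ S, w x y * (f y - f x) := by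
    intro x hx
    have h1 := h x ((hmemA x).1 hx).1
    rw [lap_eq_sum hw f x S (fun y hy => Finset.mem_union_right _
      (Finset.mem_biUnion.2 ⟨x, hx, by simpa using hy⟩))] at h1
    have h2 := mul_le_mul_of_nonneg_left h1 (hm x).le
    rwa [mul_inv_cancel_left₀ (hm x).ne'] at h2
  have hsplit : ∀ x ∈ A, ∑ y ∈ S, w x y * (f y - f x) ≤
      ∑ y ∈ A, w x y * (f y - f x) + ∑ y ∈ hK.toFinset, w x y * d x y := by
    intro x hx
    have e1 : S ∩ A = A := by
      ext y
      simp only [hS, Finset.mem_inter, Finset.mem_union]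
      tauto
    have e2 : S ∩ hK.toFinset = hK.toFinset := by
      ext y
      simp only [hS, Finset.mem_inter, Finset.mem_union]
      tauto
    rw [← e1, ← e2, ← Finset.sum_ite_mem, ← Finset.sum_ite_mem, ← Finset.sum_add_distrib]
    refine Finset.sum_le_sum fun y _ => ?_
    have hxA := (hmemA x).1 hx
    have hv : y ∈ X ∪ Y ∪ K := hU ▸ Set.mem_univ _
    by_cases hyA : y ∈ A
    · simp only [hyA, if_true]
      split_ifs
      · linarith [mul_nonneg (hw x y) (hdnn x y)]
      · linarith
    · simp only [hyA, if_false, zero_add, Set.Finite.mem_toFinset]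
      rcases hv with (hv | hv) | hv
      · rw [if_neg (Set.disjoint_left.1 hXK hv)]
        have : f y ≤ t := by
          by_contra! hlt
          exact hyA ((hmemA y).2 ⟨hv, hlt⟩)
        exact mul_nonpos_of_nonneg_of_nonpos (hw x y) (by linarith)
      · rw [if_neg (Set.disjoint_left.1 hYK hv), hE x hxA.1 y hv, zero_mul]
      · rw [if_pos hv]
        exact mul_le_mul_of_nonneg_left (hf.1 x y) (hw x y)
  have hanti : ∑ x ∈ A, ∑ y ∈ A, w x y * (f y - f x) = 0 := by
    have : ∑ x ∈ A, ∑ y ∈ A, w x y * (f y - f x) =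
        -∑ x ∈ A, ∑ y ∈ A, w x y * (f y - f x) := by
      conv_lhs => rw [Finset.sum_comm]
      rw [← Finset.sum_neg_distrib]
      refine Finset.sum_congr rfl fun x _ => ?_
      rw [← Finset.sum_neg_distrib]
      refine Finset.sum_congr rfl fun y _ => ?_
      rw [hws y x]
      ring
    linarith
  have hbdry : ∑ x ∈ A, ∑ y ∈ hK.toFinset, w x y * d x y ≤ B := by
    rw [Finset.sum_comm, hB]
    refine Finset.sum_le_sum fun k _ => ?_
    have h1 : ∑ x ∈ A, w x k * d x k ≤ ∑ x ∈ A ∪ (hl k).toFinset, w x k * d x k :=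
      Finset.sum_le_sum_of_subset_of_nonneg Finset.subset_union_left
        fun x _ _ => mul_nonneg (hw x k) (hdnn x k)
    refine h1.trans (Finset.sum_subset Finset.subset_union_right fun x _ hx => ?_).ge
    have : w x k = 0 := by
      have : ¬ 0 < w k x := by simpa using hx
      rw [hws]
      exact le_antisymm (not_lt.1 this) (hw k x)
    rw [this, zero_mul]
  have hsum : ∑ x ∈ A, m x * C ≤ B := by
    calc ∑ x ∈ A, m x * C
        ≤ ∑ x ∈ A, (∑ y ∈ A, w x y * (f y - f x) + ∑ y ∈ hK.toFinset, w x y * d x y) :=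
          Finset.sum_le_sum fun x hx => (hmul x hx).trans (hsplit x hx)
      _ ≤ B := by
          rw [Finset.sum_add_distrib, hanti, zero_add]
          exact hbdry
  have hFA : ∑ x ∈ F, m x ≤ ∑ x ∈ A, m x :=
    Finset.sum_le_sum_of_subset_of_nonneg (fun x hx => (hmemA x).2 ⟨hFX hx, ht x hx⟩)
      fun x _ _ => (hm x).le
  rw [← Finset.sum_mul] at hsum
  rw [div_lt_iff₀ hC] at hF
  have := mul_le_mul_of_nonneg_right hFA hC.le
  linarith

theorem IsExtremal.lap_ge_of_mem (hG : IsGraphBase w m d) (hκ : NonnegCurv w m d)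
    {f : V → ℝ} (hf : IsExtremal d X Y K f) {C : ℝ} (h : ∀ k ∈ K, C ≤ lap w m f k)
    {x : V} (hx : x ∈ X) : C ≤ lap w m f x := by
  obtain ⟨k, hk, e⟩ := hf.2.1 x hx
  exact (h k hk).trans (lap_le_of_sub_eq hG hκ hf.1 (by linarith))

/-- An extremal function with constant Laplacian on `K` is harmonic on `K`. -/
theorem IsExtremal.lap_const_eq_zero (hG : IsGraphBase w m d) (hκ : NonnegCurv w m d)
    (hP : SalamiPartition w m X Y K) {f : V → ℝ} (hf : IsExtremal d X Y K f) {C : ℝ}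
    (h : ∀ k ∈ K, lap w m f k = C) : C = 0 := by
  have hs := hG.2.2.2.2.2.2.2.1.2.2.1
  rcases lt_trichotomy C 0 with hC | hC | hC
  · refine (IsExtremal.not_lap_ge hG (hP.swap hG.2.1) (hf.neg_swap hs) (neg_pos.2 hC)
      fun x hx => (hf.neg_swap hs).lap_ge_of_mem hG hκ (fun k hk => ?_) hx).elim
    rw [lap_neg, h k hk]
  · exact hC
  · exact (hf.not_lap_ge hG hP hC
      fun x hx => hf.lap_ge_of_mem hG hκ (fun k hk => (h k hk).ge) hx).elim

end Flux

section Existence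

variable {w : V → V → ℝ} {m : V → ℝ} {d : V → V → ℝ} {X Y K : Set V}

/-- A non-expansive self-map of a set of functions on a finite set, closed, containing `0` and
stable under multiplication by scalars in `[0,1]`, almost has a fixed point. -/
theorem exists_discounted_fixedPoint {ι : Type*} [Fintype ι] {s : Set (ι → ℝ)}
    (hs : IsClosed s) (h0 : (0 : ι → ℝ) ∈ s)
    (hsmul : ∀ r : ℝ, 0 ≤ r → r ≤ 1 → ∀ φ ∈ s, r • φ ∈ s)
    {U : (ι → ℝ) → ι → ℝ} (hU : ∀ φ ∈ s, U φ ∈ s)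
    (hdist : ∀ φ ∈ s, ∀ ψ ∈ s, dist (U φ) (U ψ) ≤ dist φ ψ) {l : ℝ} (hl : 0 < l)
    (hl1 : l < 1) : ∃ φ ∈ s, φ = (1 - l) • U φ := by
  have : CompleteSpace s := hs.completeSpace_coe
  have : Nonempty s := ⟨⟨0, h0⟩⟩
  let T : s → s := fun φ =>
    ⟨(1 - l) • U φ, hsmul _ (by linarith) (by linarith) _ (hU _ φ.2)⟩
  have hT : ContractingWith (Real.toNNReal (1 - l)) T := by
    refine ⟨by rw [Real.toNNReal_lt_one]; linarith, LipschitzWith.of_dist_le_mul fun φ ψ => ?_⟩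
    rw [Real.coe_toNNReal _ (by linarith)]
    show dist ((1 - l) • U φ) ((1 - l) • U ψ) ≤ (1 - l) * dist (φ : ι → ℝ) ψ
    rw [dist_smul₀, Real.norm_of_nonneg (by linarith)]
    exact mul_le_mul_of_nonneg_left (hdist _ φ.2 _ ψ.2) (by linarith)
  refine ⟨hT.fixedPoint, hT.fixedPoint.2, ?_⟩
  exact (congrArg Subtype.val hT.fixedPoint_isFixedPt).symm

open Classical in
/-- Every salami partition carries an extremal function which is harmonic on `K`. -/
theorem exists_isExtremal_lap_eq_zero (hG : IsGraphBase w m d) (hκ : NonnegCurv w m d)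
    (hP : SalamiPartition w m X Y K) :
    ∃ g, IsExtremal d X Y K g ∧ ∀ k ∈ K, lap w m g k = 0 := by
  obtain ⟨-, hws, hw, hw0, hm, hl, hc, hd, hb⟩ := id hG
  obtain ⟨k₀, hk₀⟩ := hP.nonempty hd hc
  have hUniv := hP.1
  have hK := hP.2.2.2.2.1
  have : Fintype K := hK.fintype
  obtain ⟨ε, hε, hεK⟩ : ∃ ε : ℝ, 0 < ε ∧ ∀ k ∈ K, ε * deg w m k ≤ 1 / 2 := by
    have hD : 0 ≤ ∑ k ∈ hK.toFinset, deg w m k :=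
      Finset.sum_nonneg fun k _ => deg_nonneg hw hm k
    refine ⟨1 / (2 * (1 + ∑ k ∈ hK.toFinset, deg w m k)), by positivity, fun k hk => ?_⟩
    have := Finset.single_le_sum (f := deg w m) (fun k _ => deg_nonneg hw hm k)
      (hK.mem_toFinset.2 hk)
    rw [div_mul_eq_mul_div, div_le_div_iff₀ (by positivity) (by positivity)]
    linarith
  let s : Set (K → ℝ) := {φ | ∀ a b : K, φ b - φ a ≤ d a b}
  have hsclosed : IsClosed s := by
    simp only [s, Set.ofPred_forall]
    exact isClosed_iInter fun a => isClosed_iInter fun b =>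
      isClosed_le (by fun_prop) continuous_const
  let E : (K → ℝ) → V → ℝ := fun φ =>
    Sop d X Y K (fun v => if h : v ∈ K then φ ⟨v, h⟩ else 0)
  have hEK : ∀ φ (k : K), E φ k = φ k := by
    intro φ k
    simp only [E]
    rw [Sop_of_mem_K k.2]
    simp
  have hE : ∀ φ ∈ s, IsExtremal d X Y K (E φ) := by
    intro φ hφ
    refine isExtremal_Sop hd hc hP fun x hx y hy => ?_
    simpa [hx, hy] using hφ ⟨x, hx⟩ ⟨y, hy⟩
  have hEle : ∀ φ ∈ s, ∀ ψ ∈ s, ∀ c : ℝ, (∀ k, φ k ≤ ψ k + c) → ∀ v, E φ v ≤ E ψ v + c := by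
    intro φ hφ ψ hψ c h v
    refine (hE φ hφ).le_add hd.2.2.1 hUniv (hE ψ hψ) (fun k hk => ?_) v
    have := h ⟨k, hk⟩
    rwa [← hEK φ ⟨k, hk⟩, ← hEK ψ ⟨k, hk⟩] at this
  let U : (K → ℝ) → K → ℝ := fun φ k => φ k + ε * lap w m (E φ) k
  have hUs : ∀ φ ∈ s, U φ ∈ s := by
    intro φ hφ a b
    have := lip_add_mul_lap hG hκ (hE φ hφ).1 hε.le (hεK a a.2) (hεK b b.2)
    rwa [hEK, hEK] at this
  have hUle : ∀ φ ∈ s, ∀ ψ ∈ s, ∀ k, U φ k ≤ U ψ k + dist φ ψ := by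
    intro φ hφ ψ hψ k
    have := add_mul_lap_le (x := (k : V)) hw hm hl hε.le (by linarith [hεK k k.2])
      (hEle φ hφ ψ hψ (dist φ ψ) fun k => by
        have h1 := dist_le_pi_dist φ ψ k
        rw [Real.dist_eq] at h1
        linarith [le_abs_self (φ k - ψ k)])
    rwa [hEK, hEK] at this
  have hUdist : ∀ φ ∈ s, ∀ ψ ∈ s, dist (U φ) (U ψ) ≤ dist φ ψ := by
    intro φ hφ ψ hψ
    rw [dist_pi_le_iff dist_nonneg]
    intro k
    rw [Real.dist_eq, abs_le]
    have h1 := hUle φ hφ ψ hψ k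
    have h2 := hUle ψ hψ φ hφ k
    rw [dist_comm] at h2
    constructor <;> linarith
  have hlapcont : ∀ k : K, ContinuousOn (fun φ => lap w m (E φ) k) s := by
    intro k
    have hUc : ContinuousOn U s := by
      refine LipschitzOnWith.continuousOn (K := 1) (LipschitzOnWith.of_dist_le_mul ?_)
      simpa using hUdist
    have h1 : ContinuousOn (fun φ => ε⁻¹ * (U φ k - φ k)) s :=
      continuousOn_const.mul
        (((continuous_apply k).comp_continuousOn hUc).sub (continuous_apply k).continuousOn)
    refine h1.congr fun φ _ => ?_
    simp only [U]
    field_simp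
    ring
  let κ₀ : K := ⟨k₀, hk₀⟩
  let N : (K → ℝ) → ℝ := fun φ => ∑ k : K, |lap w m (E φ) k - lap w m (E φ) κ₀|
  have hNcont : ContinuousOn N s :=
    continuousOn_finsetSum _ fun k _ => ((hlapcont k).sub (hlapcont κ₀)).abs
  let s₀ : Set (K → ℝ) := s ∩ {φ | φ κ₀ = 0}
  have hs₀ : IsCompact s₀ := by
    have hcpt : IsCompact (Set.univ.pi fun k : K => Set.Icc (-d k κ₀) (d κ₀ k)) :=
      isCompact_univ_pi fun k => isCompact_Icc
    refine hcpt.of_isClosed_subset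
      (hsclosed.inter (isClosed_eq (continuous_apply κ₀) continuous_const)) ?_
    rintro φ ⟨hφ, hφ0⟩ k -
    have h1 := hφ κ₀ k
    have h2 := hφ k κ₀
    have h3 : φ κ₀ = 0 := hφ0
    exact ⟨by linarith, by linarith⟩
  have hdnn : ∀ x y, 0 ≤ d x y := by
    intro x y
    by_cases hxy : x = y
    · rw [hxy, hd.1]
    · exact (hd.2.1 x y hxy).le
  have h0s : (0 : K → ℝ) ∈ s := fun a b => by simpa using hdnn a b
  obtain ⟨φ, hφ, hmin⟩ := hs₀.exists_isMinOn ⟨0, h0s, rfl⟩ (hNcont.mono Set.inter_subset_left)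
  have hsmall : ∀ l : ℝ, 0 < l → l < 1 → N φ ≤ l * (ε⁻¹ * ∑ k : K, d κ₀ k) := by
    intro l hl0 hl1
    obtain ⟨ψ, hψ, hfix⟩ := exists_discounted_fixedPoint hsclosed h0s
      (fun r hr hr1 φ hφ a b => by
        have := mul_le_mul_of_nonneg_left (hφ a b) hr
        have h2 := mul_le_mul_of_nonneg_right hr1 (hdnn a b)
        simp only [Pi.smul_apply, smul_eq_mul]
        linarith) hUs hUdist hl0 hl1
    let χ : K → ℝ := fun k => ψ k - ψ κ₀
    have hχ : χ ∈ s := fun a b => by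
      have := hψ a b
      simp only [χ]
      linarith
    have hEχ : E ψ = fun v => E χ v + ψ κ₀ := by
      funext v
      refine le_antisymm (hEle ψ hψ χ hχ _ (fun k => by simp [χ]) v) ?_
      have := hEle χ hχ ψ hψ (-ψ κ₀) (fun k => by simp only [χ]; linarith) v
      linarith
    have hlapχ : ∀ k : K, lap w m (E χ) k = ε⁻¹ * (l * U ψ k) := by
      intro k
      have h1 : lap w m (E ψ) k = lap w m (E χ) k := by rw [hEχ, lap_add_const]
      have h2 : ψ k = (1 - l) * U ψ k := congrFun hfix k
      have h3 : U ψ k = ψ k + ε * lap w m (E ψ) k := rfl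
      rw [← h1, eq_inv_mul_iff_mul_eq₀ hε.ne']
      linarith
    refine (hmin ⟨hχ, by simp [χ]⟩ : N φ ≤ N χ).trans ?_
    rw [Finset.mul_sum, Finset.mul_sum]
    refine Finset.sum_le_sum fun k _ => ?_
    rw [hlapχ, hlapχ, ← mul_sub, ← mul_sub, abs_mul, abs_mul, abs_of_pos hl0,
      abs_of_pos (inv_pos.2 hε), mul_left_comm]
    have h1 := hUs ψ hψ κ₀ k
    have h2 := hUs ψ hψ k κ₀
    rw [hd.2.2.1] at h2
    have : |U ψ k - U ψ κ₀| ≤ d κ₀ k := abs_le.2 ⟨by linarith, h1⟩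
    have hεi := inv_nonneg.2 hε.le
    gcongr
  have hN0 : N φ ≤ 0 := by
    have hlim : Filter.Tendsto (fun l : ℝ => l * (ε⁻¹ * ∑ k : K, d κ₀ k))
        (nhdsWithin 0 (Set.Ioi 0)) (nhds 0) := by
      have : Filter.Tendsto (fun l : ℝ => l * (ε⁻¹ * ∑ k : K, d κ₀ k)) (nhds 0)
          (nhds (0 * (ε⁻¹ * ∑ k : K, d κ₀ k))) := Filter.tendsto_id.mul_const _
      rw [zero_mul] at this
      exact this.mono_left nhdsWithin_le_nhds
    refine ge_of_tendsto hlim ?_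
    filter_upwards [Ioo_mem_nhdsGT (zero_lt_one' ℝ)] with l hl
    exact hsmall l hl.1 hl.2
  have hconst : ∀ k ∈ K, lap w m (E φ) k = lap w m (E φ) k₀ := by
    intro k hk
    have h1 : |lap w m (E φ) k - lap w m (E φ) k₀| ≤ N φ :=
      Finset.single_le_sum (f := fun k : K => |lap w m (E φ) k - lap w m (E φ) κ₀|)
        (fun _ _ => abs_nonneg _) (Finset.mem_univ (⟨k, hk⟩ : K))
    exact sub_eq_zero.1 (abs_nonpos_iff.1 (h1.trans hN0))
  refine ⟨E φ, hE φ hφ.1, fun k hk => ?_⟩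
  rw [hconst k hk]
  exact (hE φ hφ.1).lap_const_eq_zero hG hκ hP hconst

end Existence

section Harmonic

variable {w : V → V → ℝ} {m : V → ℝ} {d : V → V → ℝ} {X Y K : Set V}

theorem InfVolume.diff_singleton {A : Set V} (hm : ∀ x, 0 < m x) (h : InfVolume m A) (a : V) :
    InfVolume m (A \ {a}) := by
  classical
  intro c
  obtain ⟨F, hF, hc⟩ := h (c + m a)
  refine ⟨F.erase a, fun x hx => ?_, ?_⟩
  · have := Finset.mem_erase.1 hx
    exact ⟨hF this.2, this.1⟩
  · have h1 : ∑ x ∈ F, m x ≤ ∑ x ∈ insert a (F.erase a), m x :=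
      Finset.sum_le_sum_of_subset_of_nonneg
        (Finset.insert_erase_subset a F)
        fun x _ _ => (hm x).le
    rw [Finset.sum_insert (Finset.notMem_erase a F)] at h1
    linarith

theorem ConnectedSalamiPartition.move (hws : ∀ x y, w x y = w y x) (hm : ∀ x, 0 < m x)
    (hP : ConnectedSalamiPartition w m X Y K) {a k : V} (ha : a ∈ X) (hk : k ∈ K)
    (hka : 0 < w k a) : ConnectedSalamiPartition w m (X \ {a}) Y (insert a K) := by
  obtain ⟨⟨hU, hXY, hXK, hYK, hK, hE, hvX, hvY⟩, hconn⟩ := hP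
  have hmono : ∀ x y, reachIn w K x y → reachIn w (insert a K) x y := fun x y h =>
    Relation.ReflTransGen.mono (fun _ _ h =>
      ⟨Set.mem_insert_of_mem _ h.1, Set.mem_insert_of_mem _ h.2.1, h.2.2⟩) x y h
  have hka' : reachIn w (insert a K) k a :=
    Relation.ReflTransGen.single ⟨Set.mem_insert_of_mem _ hk, Set.mem_insert _ _, hka⟩
  have hak' : reachIn w (insert a K) a k :=
    Relation.ReflTransGen.single
      ⟨Set.mem_insert _ _, Set.mem_insert_of_mem _ hk, by rwa [hws]⟩
  refine ⟨⟨?_, ?_, ?_, ?_, hK.insert a, fun x hx => hE x hx.1, hvX.diff_singleton hm a, hvY⟩, ?_⟩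
  · rw [Set.eq_univ_iff_forall] at hU ⊢
    intro x
    have := hU x
    by_cases hxa : x = a <;> simp_all
  · exact hXY.mono_left Set.sdiff_subset
  · rw [Set.disjoint_left]
    rintro x ⟨hx, hxa⟩ (h | h)
    · exact hxa h
    · exact Set.disjoint_left.1 hXK hx h
  · rw [Set.disjoint_left]
    rintro x hx (rfl | h)
    · exact Set.disjoint_left.1 hXY ha hx
    · exact Set.disjoint_left.1 hYK hx h
  · rintro x (rfl | hx) y (rfl | hy)
    · exact Relation.ReflTransGen.refl
    · exact hak'.trans (hmono _ _ (hconn k hk y hy))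
    · exact (hmono _ _ (hconn x hx k hk)).trans hka'
    · exact hmono _ _ (hconn x hx y hy)

/-- An extremal function harmonic on `K` stays harmonic on `K` when `K` is enlarged by an
adjacent vertex of `X`. -/
theorem IsExtremal.lap_eq_zero_of_adj (hG : IsGraphBase w m d) (hκ : NonnegCurv w m d)
    (hP : ConnectedSalamiPartition w m X Y K) {f : V → ℝ} (hf : IsExtremal d X Y K f)
    (h : ∀ k ∈ K, lap w m f k = 0) {a k : V} (ha : a ∈ X) (hk : k ∈ K) (hka : 0 < w k a) :
    lap w m f a = 0 := by
  obtain ⟨-, hws, hw, hw0, hm, hl, hc, hd, hb⟩ := id hG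
  have hP' := hP.move hws hm ha hk hka
  have hf' : IsExtremal d (X \ {a}) Y (insert a K) f :=
    hf.mono Set.sdiff_subset subset_rfl (Set.subset_insert _ _)
  have hlapf : ∀ p ∈ insert a K, 0 ≤ lap w m f p := by
    rintro p (rfl | hp)
    · exact hf.lap_ge_of_mem hG hκ (fun k hk => (h k hk).ge) ha
    · exact (h p hp).ge
  obtain ⟨g, hg, hg0⟩ := exists_isExtremal_lap_eq_zero hG hκ hP'.1
  obtain ⟨p, hp, hpmin⟩ := Set.exists_min_image (insert a K) (fun v => g v - f v)
    hP'.1.2.2.2.2.1 ⟨a, Set.mem_insert _ _⟩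
  have hmin : ∀ v, g p - f p ≤ g v - f v := fun v => by
    have := hf'.le_add hd.2.2.1 hP'.1.1 hg (c := -(g p - f p))
      (fun k hk => by linarith [hpmin k hk]) v
    linarith
  have hconst : ∀ q ∈ insert a K, g q - f q = g p - f p := by
    intro q hq
    induction hP'.2 p hp q hq with
    | refl => rfl
    | tail _ hbc ih =>
      have ih := ih hbc.1
      rw [← ih]
      refine sub_eq_of_min hw hm hl (fun v => ?_) ?_ hbc.2.2
      · rw [ih]
        exact hmin v
      · rw [hg0 _ hbc.1]
        exact hlapf _ hbc.1
  have hle : lap w m f a ≤ lap w m g a :=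
    lap_le_lap hw hm hl fun y _ => by
      linarith [hmin y, hconst a (Set.mem_insert _ _)]
  have hle' := hlapf a (Set.mem_insert _ _)
  rw [hg0 a (Set.mem_insert _ _)] at hle
  exact le_antisymm hle hle'

theorem ConnectedSalamiPartition.swap (hws : ∀ x y, w x y = w y x)
    (hP : ConnectedSalamiPartition w m X Y K) : ConnectedSalamiPartition w m Y X K :=
  ⟨hP.1.swap hws, hP.2⟩

/-- An extremal function harmonic on a connected `K` is harmonic everywhere. -/
theorem IsExtremal.lap_eq_zero (hG : IsGraphBase w m d) (hκ : NonnegCurv w m d)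
    (hP : ConnectedSalamiPartition w m X Y K) {f : V → ℝ} (hf : IsExtremal d X Y K f)
    (h : ∀ k ∈ K, lap w m f k = 0) (v : V) : lap w m f v = 0 := by
  obtain ⟨-, hws, hw, hw0, hm, hl, hc, hd, hb⟩ := id hG
  obtain ⟨k₀, hk₀⟩ := hP.1.nonempty hd hc
  suffices ∃ X' Y' K', ConnectedSalamiPartition w m X' Y' K' ∧ IsExtremal d X' Y' K' f ∧
      (∀ k ∈ K', lap w m f k = 0) ∧ v ∈ K' by
    obtain ⟨_, _, _, _, _, h0, hv⟩ := this
    exact h0 v hv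
  induction hc k₀ v with
  | refl => exact ⟨X, Y, K, hP, hf, h, hk₀⟩
  | @tail b a _ hba ih =>
    obtain ⟨X', Y', K', hP', hf', h', hb'⟩ := ih
    have ha : a ∈ X' ∪ Y' ∪ K' := hP'.1.1 ▸ Set.mem_univ a
    rcases ha with (ha | ha) | ha
    · refine ⟨X' \ {a}, Y', insert a K', hP'.move hws hm ha hb' hba,
        hf'.mono Set.sdiff_subset subset_rfl (Set.subset_insert _ _), ?_, Set.mem_insert _ _⟩
      rintro k (rfl | hk)
      · exact hf'.lap_eq_zero_of_adj hG hκ hP' h' ha hb' hba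
      · exact h' k hk
    · refine ⟨X', Y' \ {a}, insert a K',
        ((hP'.swap hws).move hws hm ha hb' hba).swap hws,
        hf'.mono subset_rfl Set.sdiff_subset (Set.subset_insert _ _), ?_, Set.mem_insert _ _⟩
      rintro k (rfl | hk)
      · have := (hf'.neg_swap hd.2.2.1).lap_eq_zero_of_adj hG hκ (hP'.swap hws)
          (fun k hk => by rw [lap_neg, h' k hk, neg_zero]) ha hb' hba
        rwa [lap_neg, neg_eq_zero] at this
      · exact h' k hk
    · exact ⟨X', Y', K', hP', hf', h', ha⟩

/-- Two harmonic extremal functions differ by a constant. -/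
theorem IsExtremal.eq_add_const (hG : IsGraphBase w m d) (hP : SalamiPartition w m X Y K)
    {f g : V → ℝ} (hf : IsExtremal d X Y K f) (hg : IsExtremal d X Y K g)
    (hf0 : ∀ v, lap w m f v = 0) (hg0 : ∀ v, lap w m g v = 0) :
    ∃ c : ℝ, g = fun v => f v + c := by
  obtain ⟨-, hws, hw, hw0, hm, hl, hc, hd, hb⟩ := id hG
  obtain ⟨p, hp, hpmin⟩ := Set.exists_min_image K (fun v => g v - f v)
    hP.2.2.2.2.1 (hP.nonempty hd hc)
  have hmin : ∀ v, g p - f p ≤ g v - f v := fun v => by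
    have := hf.le_add hd.2.2.1 hP.1 hg (c := -(g p - f p))
      (fun k hk => by linarith [hpmin k hk]) v
    linarith
  refine ⟨g p - f p, funext fun q => ?_⟩
  suffices g q - f q = g p - f p by linarith
  induction hc p q with
  | refl => rfl
  | tail _ hbc ih =>
    rw [← ih]
    exact sub_eq_of_min hw hm hl (fun v => by rw [ih]; exact hmin v)
      (by rw [hf0, hg0]) hbc

end Harmonic

/-- **Lemma (ℋ(P) is one function up to constants).** On a salami with connected
salami partition `P`, `ℋ(P) = h + ℝ` for some `h ∈ ℋ(P)`. -/
theorem calH_unique_up_to_constants {V : Type*} (w : V → V → ℝ) (m : V → ℝ)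
    (d : V → V → ℝ) (hS : IsSalami w m d) (X Y K : Set V)
    (hP : ConnectedSalamiPartition w m X Y K) :
    ∃ h ∈ calH w m d X Y K,
      calH w m d X Y K = {g | ∃ c : ℝ, g = fun x => h x + c} := by
  obtain ⟨hG, hκ, -⟩ := hS
  obtain ⟨-, -, -, -, -, -, hc, hd, -⟩ := id hG
  obtain ⟨h, hh, hhK⟩ := exists_isExtremal_lap_eq_zero hG hκ hP.1
  have hh0 := hh.lap_eq_zero hG hκ hP hhK
  refine ⟨h, ⟨(mem_calF_iff hd hc hP.1).2 hh, hh0⟩, Set.ext fun g => ⟨?_, ?_⟩⟩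
  · rintro ⟨hg, hg0⟩
    exact hh.eq_add_const hG hP.1 ((mem_calF_iff hd hc hP.1).1 hg) hh0 hg0
  · rintro ⟨c, rfl⟩
    exact ⟨(mem_calF_iff hd hc hP.1).2 (hh.add_const c), fun x => by rw [lap_add_const, hh0]⟩

end SalamiPaper
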